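/- In the copula-update process with learning rates α_{n+k} = C·(n+k+1)^{−β} for C > 0 and β ∈ (1/2, 1], for every fixed y ∈ ℝ, every integer N ≥ 0, and every ε > 0, P(∃ M ≥ N : |P_M(y) − P_N(y)| ≥ ε) ≤ 2·exp(−ε²·(2β − 1)·(n + N)^{2β − 1}/(2C²)). -/

import Mathlib

open MeasureTheory ProbabilityTheory Filter Topology

/-- The standard normal cumulative distribution function `Φ`. -/
noncomputable def Phi (t : ℝ) : ℝ := ((gaussianReal 0 1) (Set.Iic t)).toReal

/-- The inverse (quantile function) of the standard normal CDF. -/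
noncomputable def PhiInv (u : ℝ) : ℝ := sInf {x : ℝ | u ≤ Phi x}

/-- The Gaussian copula update function `H_ρ(u,v)`, extended by `H_ρ(0,v) = 0` and
`H_ρ(1,v) = 1`. -/
noncomputable def Hcop (ρ u v : ℝ) : ℝ :=
  if u = 0 then 0
  else if u = 1 then 1
  else Phi ((PhiInv u - ρ * PhiInv v) / Real.sqrt (1 - ρ ^ 2))

/-- The copula-update process of the martingale posterior construction: an initial random
CDF `P₀`, samples `y_{n+k}` whose conditional probability integral transform
`P_{k−1}(y_{n+k})` is uniform on `[0,1]` given `𝓕_{k−1}`, and the recursive Gaussian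
copula update `P_k(y) = (1 − α_{n+k})·P_{k−1}(y) + α_{n+k}·H_ρ(P_{k−1}(y), P_{k−1}(y_{n+k}))`.
Here `Pk k ω` is the random function `P_k` and `y k` is the random variable `y_{n+k}`. -/
structure CopulaProcess (Ω : Type*) [mΩ : MeasurableSpace Ω] (P : Measure Ω) where
  /-- the copula parameter `ρ ∈ (−1,1)` -/
  ρ : ℝ
  hρ : ρ ∈ Set.Ioo (-1 : ℝ) 1
  /-- the number `n` of originally observed data points -/
  n : ℕ
  hn : 1 ≤ n
  /-- the learning rates: `α (n+k)` is the rate `α_{n+k}` used in step `k` -/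
  α : ℕ → ℝ
  hα : ∀ k, 1 ≤ k → α (n + k) ∈ Set.Ioo (0 : ℝ) 1
  /-- the filtration `(𝓕_k)_{k ≥ 0}` -/
  ℱ : Filtration ℕ mΩ
  /-- `Pk k ω` is the random distribution function `P_k` -/
  Pk : ℕ → Ω → ℝ → ℝ
  /-- `y k` is the random variable `y_{n+k}` (for `k ≥ 1`) -/
  y : ℕ → Ω → ℝ
  /-- `P₀(t)` is `𝓕₀`-measurable for every `t` -/
  meas0 : ∀ t : ℝ, StronglyMeasurable[ℱ 0] fun ω => Pk 0 ω t
  /-- `P₀` is continuous -/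
  cont0 : ∀ ω, Continuous (Pk 0 ω)
  /-- `P₀` is strictly increasing -/
  strictMono0 : ∀ ω, StrictMono (Pk 0 ω)
  /-- `P₀` takes values in `(0,1)` (it is strictly increasing onto `(0,1)`) -/
  mem0 : ∀ ω t, Pk 0 ω t ∈ Set.Ioo (0 : ℝ) 1
  /-- `P₀` has limit `0` at `−∞` -/
  tendsto_atBot0 : ∀ ω, Tendsto (Pk 0 ω) atBot (𝓝 0)
  /-- `P₀` has limit `1` at `+∞` -/
  tendsto_atTop0 : ∀ ω, Tendsto (Pk 0 ω) atTop (𝓝 1)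
  /-- `y_{n+k}` is `𝓕_k`-measurable -/
  measy : ∀ k, 1 ≤ k → StronglyMeasurable[ℱ k] (y k)
  /-- conditionally on `𝓕_{k−1}`, the random variable `P_{k−1}(y_{n+k})` is uniformly
  distributed on `[0,1]` -/
  unif : ∀ k, 1 ≤ k → ∀ A : Set Ω, MeasurableSet[ℱ (k - 1)] A →
    ∀ u ∈ Set.Icc (0 : ℝ) 1,
      P (A ∩ {ω | Pk (k - 1) ω (y k ω) ≤ u}) = P A * ENNReal.ofReal u
  /-- the recursive Gaussian copula update defining `P_k` from `P_{k−1}` -/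
  step : ∀ k, 1 ≤ k → ∀ ω t,
    Pk k ω t = (1 - α (n + k)) * Pk (k - 1) ω t
      + α (n + k) * Hcop ρ (Pk (k - 1) ω t) (Pk (k - 1) ω (y k ω))

namespace MeasureTheory.Martingale

variable {Ω : Type*} {mΩ : MeasurableSpace Ω} {μ : Measure Ω} {𝒢 : Filtration ℕ mΩ}
  {f : ℕ → Ω → ℝ} {c : ℕ → ℝ}

lemma abs_le_sum_of_abs_sub_le (h0 : ∀ ω, f 0 ω = 0)
    (hc : ∀ j ω, |f (j + 1) ω - f j ω| ≤ c j) (j : ℕ) (ω : Ω) :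
    |f j ω| ≤ ∑ i ∈ Finset.range j, c i := by
  induction j with
  | zero => simp [h0]
  | succ j ih =>
    rw [Finset.sum_range_succ]
    have := abs_add_le (f j ω) (f (j + 1) ω - f j ω)
    rw [add_sub_cancel] at this
    linarith [hc j ω]

/-- Multiplying a martingale increment by a bounded predictable factor keeps it centered. -/
lemma condExp_mul_sub_eq_zero [IsFiniteMeasure μ] (hf : Martingale f 𝒢 μ) (j : ℕ) {W : Ω → ℝ}
    (hW : StronglyMeasurable[𝒢 j] W) {B : ℝ} (hB : ∀ ω, |W ω| ≤ B) :
    μ[W * (f (j + 1) - f j) | 𝒢 j] =ᵐ[μ] 0 := by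
  have h1 := condExp_stronglyMeasurable_mul_of_bound (𝒢.le j) hW
    ((hf.integrable (j + 1)).sub (hf.integrable j)) B (ae_of_all _ hB)
  have h2 := condExp_sub (hf.integrable (j + 1)) (hf.integrable j) (𝒢 j)
  filter_upwards [h1, h2, hf.condExp_ae_eq (Nat.le_succ j), hf.condExp_ae_eq (le_refl j)]
    with ω h1 h2 h3 h4
  simp only [Pi.sub_apply, Pi.mul_apply] at h1 h2 h3 h4
  rw [h1, h2, h3, h4]
  simp

lemma stronglyMeasurable_exp_mul (hf : Martingale f 𝒢 μ) (r : ℝ) (j : ℕ) :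
    StronglyMeasurable[𝒢 j] fun ω => Real.exp (r * f j ω) :=
  Real.continuous_exp.comp_stronglyMeasurable ((hf.stronglyAdapted j).const_mul r)

section

variable (hf : Martingale f 𝒢 μ) (h0 : ∀ ω, f 0 ω = 0)
  (hc : ∀ j ω, |f (j + 1) ω - f j ω| ≤ c j) (r : ℝ)

include h0 hc in
lemma abs_exp_mul_le_of_abs_sub_le (j : ℕ) (ω : Ω) :
    |Real.exp (r * f j ω)| ≤ Real.exp (|r| * ∑ i ∈ Finset.range j, c i) := by
  rw [Real.abs_exp, Real.exp_le_exp]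
  calc r * f j ω ≤ |r * f j ω| := le_abs_self _
    _ = |r| * |f j ω| := abs_mul _ _
    _ ≤ _ := mul_le_mul_of_nonneg_left (abs_le_sum_of_abs_sub_le h0 hc j ω) (abs_nonneg r)

include hf h0 hc in
lemma integrable_exp_mul_mul_sub_of_abs_sub_le (j : ℕ) :
    Integrable ((fun ω => Real.exp (r * f j ω)) * (f (j + 1) - f j)) μ :=
  ((hf.integrable (j + 1)).sub (hf.integrable j)).bdd_mul
    ((hf.stronglyMeasurable_exp_mul r j).mono (𝒢.le j)).aestronglyMeasurable
    (ae_of_all _ (abs_exp_mul_le_of_abs_sub_le h0 hc r j))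

variable [IsFiniteMeasure μ]

include hf h0 hc in
lemma integrable_exp_mul_of_abs_sub_le (j : ℕ) :
    Integrable (fun ω => Real.exp (r * f j ω)) μ :=
  .of_bound ((hf.stronglyMeasurable_exp_mul r j).mono (𝒢.le j)).aestronglyMeasurable _
    (ae_of_all _ (abs_exp_mul_le_of_abs_sub_le h0 hc r j))

include hf h0 hc in
lemma submartingale_exp_mul_of_abs_sub_le :
    Submartingale (fun j ω => Real.exp (r * f j ω)) 𝒢 μ := by
  refine submartingale_nat (hf.stronglyMeasurable_exp_mul r)
    (hf.integrable_exp_mul_of_abs_sub_le h0 hc r) fun j => ?_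
  have hcent := hf.condExp_mul_sub_eq_zero j (hf.stronglyMeasurable_exp_mul r j)
    (abs_exp_mul_le_of_abs_sub_le h0 hc r j)
  have hE := hf.integrable_exp_mul_of_abs_sub_le h0 hc r
  have hP := hf.integrable_exp_mul_mul_sub_of_abs_sub_le h0 hc r j
  have hmono := condExp_mono (m := 𝒢 j) ((hE j).add (hP.smul r)) (hE (j + 1))
    (ae_of_all _ fun ω => by
      have h : Real.exp (r * f (j + 1) ω) =
          Real.exp (r * f j ω) * Real.exp (r * (f (j + 1) ω - f j ω)) := by
        rw [← Real.exp_add]; ring_nf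
      simp only [Pi.add_apply, Pi.mul_apply, Pi.smul_apply, Pi.sub_apply, smul_eq_mul]
      rw [h]
      nlinarith [Real.exp_pos (r * f j ω), Real.add_one_le_exp (r * (f (j + 1) ω - f j ω))])
  have hadd := condExp_add (hE j) (hP.smul r) (𝒢 j)
  have hsmul := condExp_smul (μ := μ) r
    ((fun ω => Real.exp (r * f j ω)) * (f (j + 1) - f j)) (𝒢 j)
  have hself := condExp_of_stronglyMeasurable (𝒢.le j) (hf.stronglyMeasurable_exp_mul r j) (hE j)
  filter_upwards [hcent, hmono, hadd, hsmul] with ω hcent hmono hadd hsmul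
  rw [hadd, Pi.add_apply, hsmul, Pi.smul_apply, hcent, hself] at hmono
  simpa using hmono

include hf h0 hc in
lemma integral_exp_mul_succ_le (j : ℕ) :
    ∫ ω, Real.exp (r * f (j + 1) ω) ∂μ ≤
      Real.exp (r ^ 2 * c j ^ 2 / 2) * ∫ ω, Real.exp (r * f j ω) ∂μ := by
  have hE := hf.integrable_exp_mul_of_abs_sub_le h0 hc r
  have hP := hf.integrable_exp_mul_mul_sub_of_abs_sub_le h0 hc r j
  have hcent : ∫ ω, ((fun ω => Real.exp (r * f j ω)) * (f (j + 1) - f j)) ω ∂μ = 0 := by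
    rw [← integral_condExp (𝒢.le j), integral_congr_ae (hf.condExp_mul_sub_eq_zero j
      (hf.stronglyMeasurable_exp_mul r j) (abs_exp_mul_le_of_abs_sub_le h0 hc r j))]
    simp
  have hbound : ∀ ω, Real.exp (r * f (j + 1) ω) ≤
      Real.exp (r ^ 2 * c j ^ 2 / 2) * Real.exp (r * f j ω) + Real.sinh (r * c j) / c j *
        ((fun ω => Real.exp (r * f j ω)) * (f (j + 1) - f j)) ω := by
    intro ω
    have hcj : 0 ≤ c j := (abs_nonneg _).trans (hc j ω)
    set d := f (j + 1) ω - f j ω with hd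
    have hdc : d / c j * (r * c j) = r * d := by
      rcases hcj.eq_or_lt with h | h
      · have : d = 0 := by simpa [← h] using hc j ω
        simp [this]
      · field_simp
    have hle : |d / c j| ≤ 1 := by
      rw [abs_div, abs_of_nonneg hcj]
      exact div_le_one_of_le₀ (hc j ω) hcj
    have hconv := Real.exp_mul_le_cosh_add_mul_sinh hle (r * c j)
    have hcosh := Real.cosh_le_exp_half_sq (r * c j)
    rw [mul_pow] at hcosh
    rw [hdc] at hconv
    have hsplit : Real.exp (r * f (j + 1) ω) = Real.exp (r * f j ω) * Real.exp (r * d) := by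
      rw [← Real.exp_add, hd]; ring_nf
    rw [hsplit, Pi.mul_apply, Pi.sub_apply, ← hd]
    have := mul_le_mul_of_nonneg_left (hconv.trans (add_le_add_left hcosh _))
      (Real.exp_pos (r * f j ω)).le
    calc _ ≤ _ := this
      _ = _ := by ring
  calc ∫ ω, Real.exp (r * f (j + 1) ω) ∂μ
      ≤ ∫ ω, (Real.exp (r ^ 2 * c j ^ 2 / 2) * Real.exp (r * f j ω) +
          Real.sinh (r * c j) / c j *
            ((fun ω => Real.exp (r * f j ω)) * (f (j + 1) - f j)) ω) ∂μ :=
        integral_mono (hE _) (((hE j).const_mul _).add (hP.const_mul _)) hbound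
    _ = _ := by
        rw [integral_add ((hE j).const_mul _) (hP.const_mul _), integral_const_mul,
          integral_const_mul, hcent, mul_zero, add_zero]

end

section

variable [IsProbabilityMeasure μ] (hf : Martingale f 𝒢 μ) (h0 : ∀ ω, f 0 ω = 0)
  (hc : ∀ j ω, |f (j + 1) ω - f j ω| ≤ c j)

include hf h0 hc

lemma integral_exp_mul_le (r : ℝ) (j : ℕ) :
    ∫ ω, Real.exp (r * f j ω) ∂μ ≤ Real.exp (r ^ 2 / 2 * ∑ i ∈ Finset.range j, c i ^ 2) := by
  induction j with
  | zero => simp [h0]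
  | succ j ih =>
    calc _ ≤ _ := hf.integral_exp_mul_succ_le h0 hc r j
      _ ≤ _ := mul_le_mul_of_nonneg_left ih (Real.exp_pos _).le
      _ = _ := by rw [← Real.exp_add, Finset.sum_range_succ]; ring_nf

variable {S : ℝ} (hS : 0 < S) (hcS : ∀ m, ∑ i ∈ Finset.range m, c i ^ 2 ≤ S)
  {ε : ℝ} (hε : 0 < ε)

include hS hcS hε

lemma measure_exists_le_le_exp_of_le (m : ℕ) :
    μ {ω | ∃ j ≤ m, ε ≤ f j ω} ≤ ENNReal.ofReal (Real.exp (-ε ^ 2 / (2 * S))) := by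
  set r := ε / S with hr
  have hr0 : 0 < r := div_pos hε hS
  have hmax := maximal_ineq (hf.submartingale_exp_mul_of_abs_sub_le h0 hc r)
    (fun j ω => (Real.exp_pos _).le) (ε := (Real.exp (r * ε)).toNNReal) m
  have hset : {ω | ((Real.exp (r * ε)).toNNReal : ℝ) ≤ (Finset.range (m + 1)).sup'
      Finset.nonempty_range_add_one fun k => Real.exp (r * f k ω)} =
      {ω | ∃ j ≤ m, ε ≤ f j ω} := by
    ext ω
    simp only [Real.coe_toNNReal _ (Real.exp_pos _).le, Set.mem_ofPred_eq, Finset.le_sup'_iff,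
      Finset.mem_range, Nat.lt_succ_iff, Real.exp_le_exp, mul_le_mul_iff_right₀ hr0]
  rw [hset] at hmax
  have hint : ∫ ω in {ω | ∃ j ≤ m, ε ≤ f j ω}, Real.exp (r * f m ω) ∂μ ≤
      Real.exp (r ^ 2 / 2 * S) :=
    calc _ ≤ ∫ ω, Real.exp (r * f m ω) ∂μ :=
          setIntegral_le_integral (hf.integrable_exp_mul_of_abs_sub_le h0 hc r m)
            (ae_of_all _ fun ω => (Real.exp_pos _).le)
      _ ≤ _ := hf.integral_exp_mul_le h0 hc r m
      _ ≤ _ := Real.exp_le_exp.2 (mul_le_mul_of_nonneg_left (hcS m) (by positivity))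
  have hmax_le := hmax.trans (ENNReal.ofReal_le_ofReal hint)
  have hexp : Real.exp (r ^ 2 / 2 * S) =
      Real.exp (r * ε) * Real.exp (-ε ^ 2 / (2 * S)) := by
    rw [← Real.exp_add, hr]
    congr 1
    field_simp
    ring
  rw [hexp, ENNReal.ofReal_mul (Real.exp_pos _).le] at hmax_le
  exact (ENNReal.mul_le_mul_iff_right (by simp [Real.exp_pos]) (by simp)).1 hmax_le

/-- Time-uniform one-sided Azuma–Hoeffding inequality. -/
theorem measure_exists_le_le_exp :
    μ {ω | ∃ j, ε ≤ f j ω} ≤ ENNReal.ofReal (Real.exp (-ε ^ 2 / (2 * S))) := by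
  have hunion : {ω | ∃ j, ε ≤ f j ω} = ⋃ m, {ω | ∃ j ≤ m, ε ≤ f j ω} := by
    ext ω
    simp only [Set.mem_ofPred_eq, Set.mem_iUnion]
    exact ⟨fun ⟨j, hj⟩ => ⟨j, j, le_rfl, hj⟩, fun ⟨_, j, _, hj⟩ => ⟨j, hj⟩⟩
  have hmono : Monotone fun m => {ω | ∃ j ≤ m, ε ≤ f j ω} :=
    fun a b hab ω ⟨j, hj, h⟩ => ⟨j, hj.trans hab, h⟩
  rw [hunion, hmono.measure_iUnion]
  exact iSup_le fun m => hf.measure_exists_le_le_exp_of_le h0 hc hS hcS hε m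

/-- Time-uniform two-sided Azuma–Hoeffding inequality. -/
theorem measure_exists_le_abs_le_exp :
    μ {ω | ∃ j, ε ≤ |f j ω|} ≤ ENNReal.ofReal (2 * Real.exp (-ε ^ 2 / (2 * S))) := by
  have hpos := hf.measure_exists_le_le_exp h0 hc hS hcS hε
  have hneg := hf.neg.measure_exists_le_le_exp (c := c) (fun ω => by simp [h0])
    (fun j ω => by simpa [abs_sub_comm, neg_add_eq_sub] using hc j ω) hS hcS hε
  have hsub : {ω | ∃ j, ε ≤ |f j ω|} ⊆ {ω | ∃ j, ε ≤ f j ω} ∪ {ω | ∃ j, ε ≤ (-f) j ω} := by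
    rintro ω ⟨j, hj⟩
    rcases le_abs.1 hj with h | h
    · exact .inl ⟨j, h⟩
    · exact .inr ⟨j, h⟩
  rw [two_mul, ENNReal.ofReal_add (Real.exp_pos _).le (Real.exp_pos _).le]
  exact (measure_mono hsub).trans ((measure_union_le _ _).trans (add_le_add hpos hneg))

end

end MeasureTheory.Martingale

section NormalCDF

lemma Phi_eq_cdf : Phi = cdf (gaussianReal 0 1) :=
  funext fun t => (cdf_eq_real _ t).symm

lemma ofReal_Phi (t : ℝ) : ENNReal.ofReal (Phi t) = gaussianReal 0 1 (Set.Iic t) :=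
  ENNReal.ofReal_toReal (measure_ne_top _ _)

lemma Phi_strictMono : StrictMono Phi := by
  intro a b hab
  have hpos : 0 < cdf (gaussianReal 0 1) b - cdf (gaussianReal 0 1) a := by
    rw [← ENNReal.ofReal_pos, ← StieltjesFunction.measure_Ioc, measure_cdf, pos_iff_ne_zero]
    intro h
    have := gaussianReal_absolutelyContinuous' 0 one_ne_zero h
    simp [hab.not_ge] at this
  rw [Phi_eq_cdf]
  linarith

lemma Phi_continuous : Continuous Phi := by
  rw [Phi_eq_cdf, continuous_iff_continuousAt]
  intro x
  have hmono := monotone_cdf (gaussianReal 0 1)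
  rw [hmono.continuousAt_iff_leftLim_eq_rightLim, StieltjesFunction.rightLim_eq]
  refine le_antisymm (hmono.leftLim_le le_rfl) ?_
  have : NullSingletonClass (gaussianReal 0 1) := nullSingletonClass_gaussianReal one_ne_zero
  have h : gaussianReal 0 1 {x} = 0 := measure_singleton x
  rw [← measure_cdf (gaussianReal 0 1), StieltjesFunction.measure_singleton,
    ENNReal.ofReal_eq_zero] at h
  linarith

lemma Phi_mem_Ioo (t : ℝ) : Phi t ∈ Set.Ioo (0 : ℝ) 1 := by
  constructor
  · refine lt_of_le_of_lt ?_ (Phi_strictMono (sub_one_lt t))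
    exact ENNReal.toReal_nonneg
  · refine lt_of_lt_of_le (Phi_strictMono (lt_add_one t)) ?_
    exact measureReal_le_one

lemma range_Phi : Set.range Phi = Set.Ioo 0 1 := by
  refine Set.Subset.antisymm (Set.range_subset_iff.2 Phi_mem_Ioo) fun u hu => ?_
  have hbot := tendsto_cdf_atBot (gaussianReal 0 1)
  have htop := tendsto_cdf_atTop (gaussianReal 0 1)
  rw [← Phi_eq_cdf] at hbot htop
  refine mem_range_of_exists_le_of_exists_ge Phi_continuous ?_ ?_
  · exact ((hbot.eventually_lt_const hu.1).exists).imp fun _ => le_of_lt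
  · exact ((htop.eventually_const_lt hu.2).exists).imp fun _ => le_of_lt

lemma Phi_isEmbedding : IsEmbedding Phi :=
  Phi_strictMono.isEmbedding_of_ordConnected (range_Phi ▸ Set.ordConnected_Ioo)

lemma PhiInv_Phi (x : ℝ) : PhiInv (Phi x) = x := by
  simp only [PhiInv, Phi_strictMono.le_iff_le]
  exact csInf_Ici

lemma Phi_PhiInv {u : ℝ} (hu : u ∈ Set.Ioo (0 : ℝ) 1) : Phi (PhiInv u) = u := by
  obtain ⟨x, rfl⟩ := range_Phi.symm ▸ hu
  rw [PhiInv_Phi]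

lemma PhiInv_le_iff {u : ℝ} (hu : u ∈ Set.Ioo (0 : ℝ) 1) (z : ℝ) : PhiInv u ≤ z ↔ u ≤ Phi z := by
  rw [← Phi_strictMono.le_iff_le, Phi_PhiInv hu]

lemma Continuous.PhiInv_comp {X : Type*} [TopologicalSpace X] {p : X → ℝ} (hp : Continuous p)
    (hmem : ∀ x, p x ∈ Set.Ioo (0 : ℝ) 1) : Continuous fun x => PhiInv (p x) := by
  rw [Phi_isEmbedding.continuous_iff]
  simpa only [Function.comp_def, Phi_PhiInv (hmem _)] using hp

lemma Measurable.PhiInv_comp {X : Type*} [MeasurableSpace X] {p : X → ℝ} (hp : Measurable p)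
    (hmem : ∀ x, p x ∈ Set.Ioo (0 : ℝ) 1) : Measurable fun x => PhiInv (p x) := by
  refine measurable_of_Iic fun z => ?_
  have : (fun x => PhiInv (p x)) ⁻¹' Set.Iic z = p ⁻¹' Set.Iic (Phi z) :=
    Set.ext fun x => PhiInv_le_iff (hmem x) z
  rw [this]
  exact hp measurableSet_Iic

lemma map_prod_gaussianReal_of_sq_add_sq {a b : ℝ} (hab : a ^ 2 + b ^ 2 = 1) :
    ((gaussianReal 0 1).prod (gaussianReal 0 1)).map (fun p => a * p.1 + b * p.2) =
      gaussianReal 0 1 := by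
  have hcomp : (fun p : ℝ × ℝ => a * p.1 + b * p.2) =
      (fun p : ℝ × ℝ => p.1 + p.2) ∘ Prod.map (a * ·) (b * ·) := rfl
  rw [hcomp, ← Measure.map_map (by fun_prop) (by fun_prop),
    ← Measure.map_prod_map _ _ (by fun_prop) (by fun_prop)]
  change ((gaussianReal 0 1).map (a * ·)) ∗ ((gaussianReal 0 1).map (b * ·)) = _
  rw [gaussianReal_map_const_mul, gaussianReal_map_const_mul, gaussianReal_conv_gaussianReal]
  congr 1
  · simp
  · exact NNReal.eq (by simpa using hab)

/-- The Gaussian copula update averages to the identity over a standard normal argument. -/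
lemma integral_Phi_sub_mul_div {ρ : ℝ} (hρ : ρ ∈ Set.Ioo (-1 : ℝ) 1) (x : ℝ) :
    ∫ z, Phi ((x - ρ * z) / √(1 - ρ ^ 2)) ∂(gaussianReal 0 1) = Phi x := by
  have hpos : 0 < 1 - ρ ^ 2 := by nlinarith [hρ.1, hρ.2]
  have hs : 0 < √(1 - ρ ^ 2) := Real.sqrt_pos.2 hpos
  have hset : MeasurableSet {p : ℝ × ℝ | ρ * p.1 + √(1 - ρ ^ 2) * p.2 ≤ x} :=
    measurableSet_le (by fun_prop) (by fun_prop)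
  have hfiber : ∀ z, Phi ((x - ρ * z) / √(1 - ρ ^ 2)) =
      (gaussianReal 0 1 (Prod.mk z ⁻¹' {p | ρ * p.1 + √(1 - ρ ^ 2) * p.2 ≤ x})).toReal := by
    intro z
    rw [Phi]
    congr 2
    ext w
    simp only [Set.mem_Iic, Set.mem_preimage, Set.mem_ofPred_eq, le_div_iff₀ hs]
    constructor <;> intro h <;> linarith
  simp_rw [hfiber]
  rw [integral_toReal (measurable_measure_prodMk_left hset).aemeasurable
    (ae_of_all _ fun _ => measure_lt_top _ _), ← Measure.prod_apply hset, Phi]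
  conv_rhs => rw [← map_prod_gaussianReal_of_sq_add_sq (a := ρ) (b := √(1 - ρ ^ 2))
    (by rw [Real.sq_sqrt hpos.le]; ring), Measure.map_apply (by fun_prop) measurableSet_Iic]
  rfl

end NormalCDF

namespace CopulaProcess

variable {Ω : Type*} [mΩ : MeasurableSpace Ω] {P : Measure Ω} (Q : CopulaProcess Ω P)

/-- The normal score `Φ⁻¹(P_k(y_{n+k+1}))` of the sample driving step `k + 1`. -/
noncomputable def score (k : ℕ) (ω : Ω) : ℝ := PhiInv (Q.Pk k ω (Q.y (k + 1) ω))

lemma Pk_mem_Ioo (k : ℕ) (ω : Ω) (t : ℝ) : Q.Pk k ω t ∈ Set.Ioo (0 : ℝ) 1 := by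
  induction k with
  | zero => exact Q.mem0 ω t
  | succ k ih =>
    have hα := Q.hα (k + 1) (Nat.le_add_left 1 k)
    rw [Q.step (k + 1) (Nat.le_add_left 1 k), Nat.add_sub_cancel, Hcop, if_neg ih.1.ne',
      if_neg ih.2.ne]
    exact convex_Ioo (0 : ℝ) 1 ih (Phi_mem_Ioo _) (sub_nonneg.2 hα.2.le) hα.1.le
      (sub_add_cancel _ _)

lemma Pk_succ (k : ℕ) (ω : Ω) (t : ℝ) :
    Q.Pk (k + 1) ω t = (1 - Q.α (Q.n + (k + 1))) * Q.Pk k ω t + Q.α (Q.n + (k + 1)) *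
      Phi ((PhiInv (Q.Pk k ω t) - Q.ρ * Q.score k ω) / √(1 - Q.ρ ^ 2)) := by
  have h := Q.Pk_mem_Ioo k ω t
  rw [Q.step (k + 1) (Nat.le_add_left 1 k), Nat.add_sub_cancel, Hcop, if_neg h.1.ne',
    if_neg h.2.ne, score]

lemma continuous_Pk (k : ℕ) (ω : Ω) : Continuous (Q.Pk k ω) := by
  induction k with
  | zero => exact Q.cont0 ω
  | succ k ih =>
    have h := ih.PhiInv_comp (Q.Pk_mem_Ioo k ω)
    have hPhi := Phi_continuous
    simp_rw [funext (Q.Pk_succ k ω)]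
    fun_prop

lemma measurable_score_of_stronglyMeasurable_Pk {k : ℕ}
    (h : ∀ t, StronglyMeasurable[Q.ℱ k] fun ω => Q.Pk k ω t) :
    Measurable[Q.ℱ (k + 1)] (Q.score k) := by
  have hjoint := @stronglyMeasurable_uncurry_of_continuous_of_stronglyMeasurable
    Ω ℝ ℝ _ _ _ _ _ _ _ (Q.ℱ (k + 1)) (fun t ω => Q.Pk k ω t) (Q.continuous_Pk k)
    fun t => (h t).mono (Q.ℱ.mono (Nat.le_add_right k 1))
  have hy := (Q.measy (k + 1) (Nat.le_add_left 1 k)).measurable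
  exact @Measurable.PhiInv_comp Ω (Q.ℱ (k + 1)) _
    (hjoint.measurable.comp (hy.prodMk (@measurable_id Ω (Q.ℱ (k + 1)))))
    fun ω => Q.Pk_mem_Ioo k ω _

lemma stronglyMeasurable_Pk (k : ℕ) (t : ℝ) :
    StronglyMeasurable[Q.ℱ k] fun ω => Q.Pk k ω t := by
  induction k generalizing t with
  | zero => exact Q.meas0 t
  | succ k ih =>
    have hscore := Q.measurable_score_of_stronglyMeasurable_Pk ih
    have hP := ((ih t).mono (Q.ℱ.mono (Nat.le_add_right k 1))).measurable
    have hInv := @Measurable.PhiInv_comp Ω (Q.ℱ (k + 1)) _ hP fun ω => Q.Pk_mem_Ioo k ω t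
    have hPhi := Phi_continuous.measurable
    simp_rw [Q.Pk_succ k]
    refine Measurable.stronglyMeasurable ?_
    exact (hP.const_mul _).add
      ((hPhi.comp ((hInv.sub (hscore.const_mul _)).div_const _)).const_mul _)

lemma measurable_score (k : ℕ) : Measurable (Q.score k) :=
  (Q.measurable_score_of_stronglyMeasurable_Pk (Q.stronglyMeasurable_Pk k)).mono
    (Q.ℱ.le (k + 1)) le_rfl

/-- The normal score is standard normal on every event of the past. -/
lemma map_score_restrict [IsFiniteMeasure P] (k : ℕ) {A : Set Ω}
    (hA : MeasurableSet[Q.ℱ k] A) :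
    (P.restrict A).map (Q.score k) = P A • gaussianReal 0 1 := by
  refine Measure.ext_of_Iic _ _ fun z => ?_
  have hz : Q.score k ⁻¹' Set.Iic z = {ω | Q.Pk k ω (Q.y (k + 1) ω) ≤ Phi z} :=
    Set.ext fun ω => PhiInv_le_iff (Q.Pk_mem_Ioo k ω _) z
  rw [Measure.map_apply (Q.measurable_score k) measurableSet_Iic,
    Measure.restrict_apply (Q.measurable_score k measurableSet_Iic), Set.inter_comm, hz,
    Measure.smul_apply, smul_eq_mul, ← ofReal_Phi]
  exact Q.unif (k + 1) (Nat.le_add_left 1 k) A hA _ (Set.Ioo_subset_Icc_self (Phi_mem_Ioo z))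

lemma map_prodMk_score_restrict [IsFiniteMeasure P] (k : ℕ) {A : Set Ω}
    (hA : MeasurableSet[Q.ℱ k] A) {X : Ω → ℝ} (hX : Measurable[Q.ℱ k] X) :
    (P.restrict A).map (fun ω => (X ω, Q.score k ω)) =
      ((P.restrict A).map X).prod (gaussianReal 0 1) := by
  have hX' : Measurable X := hX.mono (Q.ℱ.le k) le_rfl
  refine (Measure.prod_eq fun s u hs hu => ?_).symm
  rw [Measure.map_apply (hX'.prodMk (Q.measurable_score k)) (hs.prod hu),
    Measure.map_apply hX' hs, Set.mk_preimage_prod,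
    Measure.restrict_apply ((hX' hs).inter (Q.measurable_score k hu)),
    Measure.restrict_apply (hX' hs)]
  have h := congrArg (· u) (Q.map_score_restrict k ((hX hs).inter hA))
  simp only [Measure.smul_apply, smul_eq_mul] at h
  rw [← h, Measure.map_apply (Q.measurable_score k) hu,
    Measure.restrict_apply (Q.measurable_score k hu)]
  congr 1
  ext ω
  simp only [Set.mem_inter_iff]
  tauto

lemma setIntegral_Phi_score [IsFiniteMeasure P] (k : ℕ) (t : ℝ) {A : Set Ω}
    (hA : MeasurableSet[Q.ℱ k] A) :
    ∫ ω in A, Phi ((PhiInv (Q.Pk k ω t) - Q.ρ * Q.score k ω) / √(1 - Q.ρ ^ 2)) ∂P =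
      ∫ ω in A, Q.Pk k ω t ∂P := by
  have hX : Measurable[Q.ℱ k] fun ω => PhiInv (Q.Pk k ω t) :=
    @Measurable.PhiInv_comp Ω (Q.ℱ k) _ (Q.stronglyMeasurable_Pk k t).measurable
      fun ω => Q.Pk_mem_Ioo k ω t
  have hX' : Measurable fun ω => PhiInv (Q.Pk k ω t) := hX.mono (Q.ℱ.le k) le_rfl
  have hPhi := Phi_continuous
  have hcont : Continuous fun p : ℝ × ℝ => Phi ((p.1 - Q.ρ * p.2) / √(1 - Q.ρ ^ 2)) := by
    fun_prop
  calc _ = ∫ p, Phi ((p.1 - Q.ρ * p.2) / √(1 - Q.ρ ^ 2))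
        ∂((P.restrict A).map fun ω => (PhiInv (Q.Pk k ω t), Q.score k ω)) :=
        (integral_map (hX'.prodMk (Q.measurable_score k)).aemeasurable
          hcont.aestronglyMeasurable).symm
    _ = ∫ x, Phi x ∂((P.restrict A).map fun ω => PhiInv (Q.Pk k ω t)) := by
        rw [Q.map_prodMk_score_restrict k hA hX, integral_prod _
          (.of_bound hcont.aestronglyMeasurable 1 (ae_of_all _ fun p => ?_))]
        · simp_rw [integral_Phi_sub_mul_div Q.hρ]
        · rw [Real.norm_of_nonneg (Phi_mem_Ioo _).1.le]
          exact (Phi_mem_Ioo _).2.le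
    _ = _ := by
        rw [integral_map hX'.aemeasurable hPhi.aestronglyMeasurable]
        simp_rw [Phi_PhiInv (Q.Pk_mem_Ioo k _ t)]

lemma integrable_Pk [IsFiniteMeasure P] (k : ℕ) (t : ℝ) : Integrable (fun ω => Q.Pk k ω t) P := by
  refine .of_bound ((Q.stronglyMeasurable_Pk k t).mono (Q.ℱ.le k)).aestronglyMeasurable 1
    (ae_of_all _ fun ω => ?_)
  rw [Real.norm_of_nonneg (Q.Pk_mem_Ioo k ω t).1.le]
  exact (Q.Pk_mem_Ioo k ω t).2.le

lemma martingale_Pk [IsFiniteMeasure P] (t : ℝ) :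
    Martingale (fun k ω => Q.Pk k ω t) Q.ℱ P := by
  refine martingale_of_setIntegral_eq_succ (fun k => Q.stronglyMeasurable_Pk k t)
    (fun k => Q.integrable_Pk k t) fun k A hA => ?_
  have hα := (Q.hα (k + 1) (Nat.le_add_left 1 k)).1.ne'
  have hint : Integrable (fun ω => Q.α (Q.n + (k + 1)) *
      Phi ((PhiInv (Q.Pk k ω t) - Q.ρ * Q.score k ω) / √(1 - Q.ρ ^ 2))) (P.restrict A) := by
    refine (((Q.integrable_Pk (k + 1) t).sub
      ((Q.integrable_Pk k t).const_mul (1 - Q.α (Q.n + (k + 1))))).integrableOn (s := A)).congr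
      (ae_of_all _ fun ω => ?_)
    simp [Q.Pk_succ k]
  simp_rw [Q.Pk_succ k]
  rw [integral_add ((Q.integrable_Pk k t).integrableOn.const_mul _) hint, integral_const_mul,
    integral_const_mul, Q.setIntegral_Phi_score k t hA]
  ring

lemma abs_Pk_succ_sub_le (k : ℕ) (ω : Ω) (t : ℝ) :
    |Q.Pk (k + 1) ω t - Q.Pk k ω t| ≤ Q.α (Q.n + (k + 1)) := by
  have hα := (Q.hα (k + 1) (Nat.le_add_left 1 k)).1
  have hp := Q.Pk_mem_Ioo k ω t
  have hh := Phi_mem_Ioo ((PhiInv (Q.Pk k ω t) - Q.ρ * Q.score k ω) / √(1 - Q.ρ ^ 2))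
  rw [Q.Pk_succ]
  set h := Phi ((PhiInv (Q.Pk k ω t) - Q.ρ * Q.score k ω) / √(1 - Q.ρ ^ 2))
  have hfac : (1 - Q.α (Q.n + (k + 1))) * Q.Pk k ω t + Q.α (Q.n + (k + 1)) * h - Q.Pk k ω t =
      Q.α (Q.n + (k + 1)) * (h - Q.Pk k ω t) := by ring
  rw [hfac, abs_mul, abs_of_pos hα]
  exact mul_le_of_le_one_right hα.le (abs_le.2 ⟨by linarith [hh.1, hp.2], by linarith [hh.2, hp.1]⟩)

end CopulaProcess

/-- The filtration obtained by dropping the first `N` time steps. -/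
def MeasureTheory.Filtration.shift {Ω : Type*} {mΩ : MeasurableSpace Ω} (𝒢 : Filtration ℕ mΩ)
    (N : ℕ) : Filtration ℕ mΩ where
  seq j := 𝒢 (N + j)
  mono' _ _ h := 𝒢.mono (Nat.add_le_add_left h N)
  le' _ := 𝒢.le _

lemma MeasureTheory.Martingale.shift_sub {Ω : Type*} {mΩ : MeasurableSpace Ω} {μ : Measure Ω}
    [IsFiniteMeasure μ] {𝒢 : Filtration ℕ mΩ} {f : ℕ → Ω → ℝ} (hf : Martingale f 𝒢 μ) (N : ℕ) :
    Martingale (fun j ω => f (N + j) ω - f N ω) (𝒢.shift N) μ := by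
  have h1 : Martingale (fun j => f (N + j)) (𝒢.shift N) μ :=
    ⟨fun j => hf.1 (N + j), fun i j hij => hf.2 _ _ (Nat.add_le_add_left hij N)⟩
  exact h1.sub (martingale_const_fun _ μ (hf.1 N) (hf.integrable N))

lemma mul_rpow_neg_add_one_le_sub {p x : ℝ} (hp : 0 < p) (hx : 0 < x) :
    p * (x + 1) ^ (-(p + 1)) ≤ x ^ (-p) - (x + 1) ^ (-p) := by
  have hx1 : 0 < x + 1 := by linarith
  have hlog : Real.log (x / (x + 1)) ≤ -(1 / (x + 1)) := by
    refine (Real.log_le_sub_one_of_pos (div_pos hx hx1)).trans_eq ?_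
    field_simp
    ring
  have hbern : 1 + p / (x + 1) ≤ (x / (x + 1)) ^ (-p) := by
    rw [Real.rpow_def_of_pos (div_pos hx hx1)]
    refine le_trans ?_ (Real.add_one_le_exp _)
    have := mul_le_mul_of_nonneg_left hlog hp.le
    rw [div_eq_mul_one_div p]
    linarith
  have hpow : (x + 1) ^ (-(p + 1)) = (x + 1) ^ (-p) / (x + 1) := by
    rw [neg_add, ← sub_eq_add_neg, Real.rpow_sub_one hx1.ne']
  rw [Real.div_rpow hx.le hx1.le, le_div_iff₀ (Real.rpow_pos_of_pos hx1 _)] at hbern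
  rw [hpow]
  calc _ = (1 + p / (x + 1)) * (x + 1) ^ (-p) - (x + 1) ^ (-p) := by ring
    _ ≤ _ := by linarith

lemma sum_range_add_rpow_neg_le {p x : ℝ} (hp : 0 < p) (hx : 0 < x) (m : ℕ) :
    ∑ j ∈ Finset.range m, (x + j + 1) ^ (-(p + 1)) ≤ x ^ (-p) / p := by
  rw [le_div_iff₀' hp, Finset.mul_sum]
  calc _ ≤ ∑ j ∈ Finset.range m, ((x + j) ^ (-p) - (x + (j + 1 : ℕ)) ^ (-p)) := by
        refine Finset.sum_le_sum fun j _ => ?_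
        rw [Nat.cast_add_one, ← add_assoc]
        exact mul_rpow_neg_add_one_le_sub hp (by positivity)
    _ = x ^ (-p) - (x + m) ^ (-p) := by
        rw [Finset.sum_range_sub' fun j : ℕ => (x + j) ^ (-p)]
        simp
    _ ≤ _ := sub_le_self _ (by positivity)

/-- In the copula-update process with learning rates `α_{n+k} = C·(n+k+1)^{−β}` for
`C > 0` and `β ∈ (1/2, 1]`, for every fixed `y ∈ ℝ`, every `N ≥ 0`, and every `ε > 0`,
`P(∃ M ≥ N, |P_M(y) − P_N(y)| ≥ ε) ≤ 2·exp(−ε²·(2β − 1)·(n + N)^{2β − 1}/(2C²))`. -/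
theorem copulaProcess_time_uniform_concentration {Ω : Type*} [mΩ : MeasurableSpace Ω]
    (P : Measure Ω) [IsProbabilityMeasure P] (Q : CopulaProcess Ω P)
    (C β : ℝ) (hC : 0 < C) (hβ : β ∈ Set.Ioc (1 / 2 : ℝ) 1)
    (hrate : ∀ k, 1 ≤ k → Q.α (Q.n + k) = C * ((Q.n : ℝ) + k + 1) ^ (-β))
    (t : ℝ) (N : ℕ) (ε : ℝ) (hε : 0 < ε) :
    P {ω | ∃ M : ℕ, N ≤ M ∧ ε ≤ |Q.Pk M ω t - Q.Pk N ω t|} ≤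
      ENNReal.ofReal
        (2 * Real.exp (-(ε ^ 2 * (2 * β - 1) * ((Q.n : ℝ) + N) ^ (2 * β - 1)) /
          (2 * C ^ 2))) := by
  have hp : 0 < 2 * β - 1 := by linarith [hβ.1]
  have hn : (1 : ℝ) ≤ Q.n := by exact_mod_cast Q.hn
  have hx : (0 : ℝ) < Q.n + N := by positivity
  have hsum : ∀ m, ∑ j ∈ Finset.range m, Q.α (Q.n + (N + j + 1)) ^ 2 ≤
      C ^ 2 * (((Q.n : ℝ) + N) ^ (-(2 * β - 1)) / (2 * β - 1)) := by
    intro m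
    calc _ = C ^ 2 * ∑ j ∈ Finset.range m, ((Q.n + N + 1 : ℝ) + j + 1) ^ (-(2 * β - 1 + 1)) := by
          rw [Finset.mul_sum]
          refine Finset.sum_congr rfl fun j _ => ?_
          have hbase : (Q.n : ℝ) + ((N + j + 1 : ℕ) : ℝ) + 1 = (Q.n + N + 1 : ℝ) + j + 1 := by
            push_cast; ring
          rw [hrate _ (Nat.le_add_left 1 _), hbase, mul_pow, ← Real.rpow_mul_natCast (by positivity)]
          congr 2
          push_cast; ring
      _ ≤ C ^ 2 * ((Q.n + N + 1 : ℝ) ^ (-(2 * β - 1)) / (2 * β - 1)) :=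
          mul_le_mul_of_nonneg_left (sum_range_add_rpow_neg_le hp (by positivity) m) (sq_nonneg C)
      _ ≤ _ := by
          gcongr ?_ * (?_ / ?_)
          exact Real.rpow_le_rpow_of_nonpos hx (by linarith) (by linarith)
  have hset : {ω | ∃ M : ℕ, N ≤ M ∧ ε ≤ |Q.Pk M ω t - Q.Pk N ω t|} =
      {ω | ∃ j, ε ≤ |Q.Pk (N + j) ω t - Q.Pk N ω t|} := by
    ext ω
    constructor
    · rintro ⟨M, hM, h⟩
      exact ⟨M - N, by rwa [Nat.add_sub_cancel' hM]⟩
    · rintro ⟨j, h⟩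
      exact ⟨N + j, Nat.le_add_right N j, h⟩
  rw [hset]
  refine (((Q.martingale_Pk t).shift_sub N).measure_exists_le_abs_le_exp
    (c := fun j => Q.α (Q.n + (N + j + 1))) (by simp) (fun j ω => ?_) (by positivity) hsum
    hε).trans_eq ?_
  · rw [sub_sub_sub_cancel_right]
    exact Q.abs_Pk_succ_sub_le (N + j) ω t
  · congr 3
    rw [Real.rpow_neg hx.le]
    have := Real.rpow_pos_of_pos hx (2 * β - 1)
    field_simp
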